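/- arXiv:1610.07019 — 2 statements merged into one kernel-verified Lean document; each statement's English description precedes it below -/
import Mathlib

section
/- Assume b ≤ a and b ≤ c. Then the configuration σ_{[1,2,3,2]} is a G₄-periodic ground state; more generally, for every integer n ≥ 1 the configuration whose level sequence has period 2n given by k_0 = 1, k_j = 2 for odd j, and k_j = 3 for even j with 2 ≤ j ≤ 2n−1, is a G_{2n}-periodic ground state of the λ-model. -/
/-- Vertices of the semi-infinite Cayley tree of order 2: finite words over a
two-letter alphabet (the root is the empty word). -/
abbrev Vertex : Type := List (Fin 2)

/-- Spin configurations: the values `0, 1, 2` of `Fin 3` encode the spins `1, 2, 3`. -/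
abbrev Config : Type := Vertex → Fin 3

/-- The interaction `λ`: it equals `a` if `|i - j| = 2`, `b` if `|i - j| = 1`,
and `c` if `i = j`. -/
noncomputable def lam (a b c : ℝ) (i j : Fin 3) : ℝ :=
  if ((i : ℤ) - (j : ℤ)).natAbs = 2 then a
  else if ((i : ℤ) - (j : ℤ)).natAbs = 1 then b
  else c

/-- The ball energy `U_x(σ) = (λ(σ(x),σ(x1)) + λ(σ(x),σ(x2)))/2`. -/
noncomputable def ballEnergy (a b c : ℝ) (σ : Config) (x : Vertex) : ℝ :=
  (lam a b c (σ x) (σ (x ++ [0])) + lam a b c (σ x) (σ (x ++ [1]))) / 2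

/-- `min {(α+β)/2 : α, β ∈ {a,b,c}}`. -/
noncomputable def minEnergy (a b c : ℝ) : ℝ :=
  sInf {u : ℝ | ∃ α ∈ ({a, b, c} : Set ℝ), ∃ β ∈ ({a, b, c} : Set ℝ), u = (α + β) / 2}

/-- A configuration is a ground state if every ball energy attains the minimal value. -/
def IsGroundState (a b c : ℝ) (σ : Config) : Prop :=
  ∀ x : Vertex, ballEnergy a b c σ x = minEnergy a b c

/-- `σ` is `G_m`-periodic if `σ(g ∘ x) = σ(x)` whenever `m` divides the length of `g`. -/
def GPeriodic (m : ℕ) (σ : Config) : Prop :=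
  ∀ g x : Vertex, m ∣ g.length → σ (g ++ x) = σ x

/-- `σ` is translation-invariant if `σ(g ∘ x) = σ(x)` for all words `g`. -/
def TranslationInvariant (σ : Config) : Prop :=
  ∀ g x : Vertex, σ (g ++ x) = σ x

/-- The configuration with level sequence of period `2n` given by `k_0 = 1`,
`k_j = 2` for odd `j`, and `k_j = 3` for even `j` with `2 ≤ j ≤ 2n - 1`;
for `n = 2` this is `σ_{[1,2,3,2]}`. -/
def sigmaA4 (n : ℕ) : Config := fun x =>
  if x.length % (2 * n) = 0 then 0
  else if (x.length % (2 * n)) % 2 = 1 then 1 else 2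

/-- If `b` is the smallest of the three parameters, then the minimal ball energy is `b`. -/
theorem minEnergy_eq_of_le {a b c : ℝ} (hba : b ≤ a) (hbc : b ≤ c) : minEnergy a b c = b := by
  have hle : ∀ α ∈ ({a, b, c} : Set ℝ), b ≤ α := by
    rintro α (rfl | rfl | rfl)
    exacts [hba, le_rfl, hbc]
  refine IsLeast.csInf_eq ⟨⟨b, by simp, b, by simp, by ring⟩, ?_⟩
  rintro u ⟨α, hα, β, hβ, rfl⟩
  linarith [hle α hα, hle β hβ]

/-- The interaction of two spins is `b` when exactly one of them is the middle spin. -/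
theorem lam_eq_of_iff_not (a b c : ℝ) {i j : Fin 3} (h : j = 1 ↔ ¬ i = 1) :
    lam a b c i j = b := by
  fin_cases i <;> fin_cases j <;> simp_all [lam]

/-- The middle spin sits exactly at the odd levels of `sigmaA4 n`. -/
theorem sigmaA4_eq_one_iff (n : ℕ) (x : Vertex) : sigmaA4 n x = 1 ↔ x.length % 2 = 1 := by
  have hmod : x.length % (2 * n) % 2 = x.length % 2 :=
    Nat.mod_mod_of_dvd _ (Dvd.intro n rfl)
  rw [← hmod, sigmaA4]
  split_ifs with h0 h1
  · simp [h0]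
  · simp [h1]
  · exact iff_of_false (by decide) h1

theorem gPeriodic_sigmaA4 (n : ℕ) : GPeriodic (2 * n) (sigmaA4 n) := by
  intro g x hg
  have hmod : (g ++ x).length % (2 * n) = x.length % (2 * n) := by
    rw [List.length_append, Nat.add_mod, Nat.mod_eq_zero_of_dvd hg, zero_add, Nat.mod_mod]
  simp only [sigmaA4, hmod]

theorem isGroundState_sigmaA4 {a b c : ℝ} (hba : b ≤ a) (hbc : b ≤ c) (n : ℕ) :
    IsGroundState a b c (sigmaA4 n) := by
  intro x
  have hedge : ∀ i : Fin 2, lam a b c (sigmaA4 n x) (sigmaA4 n (x ++ [i])) = b := by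
    intro i
    apply lam_eq_of_iff_not
    rw [sigmaA4_eq_one_iff, sigmaA4_eq_one_iff, List.length_append, List.length_singleton]
    omega
  rw [ballEnergy, hedge, hedge, minEnergy_eq_of_le hba hbc, add_self_div_two]

/-- if `b ≤ a` and `b ≤ c`, then `σ_{[1,2,3,2]}` is a `G₄`-periodic
ground state and, more generally, for every `n ≥ 1` the above configuration is a
`G_{2n}`-periodic ground state. -/
theorem stmt6 (a b c : ℝ) (hba : b ≤ a) (hbc : b ≤ c) :
    (GPeriodic 4 (sigmaA4 2) ∧ IsGroundState a b c (sigmaA4 2)) ∧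
    (∀ n : ℕ, 1 ≤ n →
      GPeriodic (2 * n) (sigmaA4 n) ∧ IsGroundState a b c (sigmaA4 n)) := by
  exact ⟨⟨gPeriodic_sigmaA4 2, isGroundState_sigmaA4 hba hbc 2⟩,
    fun n _ => ⟨gPeriodic_sigmaA4 n, isGroundState_sigmaA4 hba hbc n⟩⟩
end

section
/- Assume b = c ≤ a. For every sequence t : ℕ → {2,3}, the configuration σ defined by σ(x) = t_{|x|} is a ground state. In particular, the set of ground states of the λ-model is uncountable. -/
theorem lam_eq_of_mem {a b c : ℝ} (hbc : b = c) {i j : Fin 3} (hi : i = 1 ∨ i = 2)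
    (hj : j = 1 ∨ j = 2) : lam a b c i j = c := by
  rcases hi with rfl | rfl <;> rcases hj with rfl | rfl <;> simp [lam, hbc]

theorem minEnergy_eq {a b c : ℝ} (hbc : b = c) (hca : c ≤ a) : minEnergy a b c = c := by
  have hmin : ∀ α ∈ ({a, b, c} : Set ℝ), c ≤ α := by
    rintro α (rfl | rfl | rfl)
    exacts [hca, hbc.ge, le_rfl]
  refine IsLeast.csInf_eq ⟨⟨c, by simp, c, by simp, by ring⟩, ?_⟩
  rintro u ⟨α, hα, β, hβ, rfl⟩
  linarith [hmin α hα, hmin β hβ]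

theorem isGroundState_comp_length {a b c : ℝ} (hbc : b = c) (hca : c ≤ a) {t : ℕ → Fin 3}
    (ht : ∀ n : ℕ, t n = 1 ∨ t n = 2) : IsGroundState a b c (fun x => t x.length) := by
  intro x
  simp only [ballEnergy, lam_eq_of_mem hbc (ht _) (ht _), minEnergy_eq hbc hca]
  ring

/-- The level-dependent configuration with spins `2` and `3` given by a subset of levels. -/
def levelConfig (s : ℕ → Bool) : Config := fun x => if s x.length then 1 else 2

theorem levelConfig_injective : Function.Injective levelConfig := by
  intro s s' h
  funext n
  have hn := congrFun h (List.replicate n 0)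
  simp only [levelConfig, List.length_replicate] at hn
  revert hn
  cases s n <;> cases s' n <;> decide

/-- if `b = c ≤ a`, then for every sequence `t : ℕ → {2,3}`
(the values `1, 2` of `Fin 3` encode spins `2, 3`) the configuration
`σ(x) = t_{|x|}` is a ground state, and the set of ground states is uncountable. -/
theorem stmt9 (a b c : ℝ) (hbc : b = c) (hca : c ≤ a) :
    (∀ t : ℕ → Fin 3, (∀ n : ℕ, t n = 1 ∨ t n = 2) →
      IsGroundState a b c (fun x => t x.length)) ∧
    ¬ {σ : Config | IsGroundState a b c σ}.Countable := by
  refine ⟨fun t ht => isGroundState_comp_length hbc hca ht, fun hcount => ?_⟩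
  have hpre := hcount.preimage levelConfig_injective
  have huniv : levelConfig ⁻¹' {σ : Config | IsGroundState a b c σ} = Set.univ := by
    refine Set.eq_univ_of_forall fun s => ?_
    refine isGroundState_comp_length (t := fun n => if s n then 1 else 2) hbc hca fun n => ?_
    cases s n <;> simp
  rw [huniv, Set.countable_univ_iff] at hpre
  refine (Cardinal.cantor Cardinal.aleph0).not_ge ?_
  have hle : Cardinal.mk (ℕ → Bool) ≤ Cardinal.aleph0 := Cardinal.mk_le_aleph0_iff.mpr hpre
  rwa [← Cardinal.power_def, Cardinal.mk_bool, Cardinal.mk_nat] at hle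
end
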